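/- For every integer n ≥ 3, there is no injective function f from ZMod n to the Euclidean plane (EuclideanSpace ℝ (Fin 2)) such that for every i in ZMod n, the unoriented angle ∠ f(i−1) f(i) f(i+1) equals π. -/

import Mathlib

open EuclideanGeometry

/-- Cycle graphs cannot be drawn with straight edges and perfect angular resolution:
for `n ≥ 3` there is no injective map `f : ZMod n → ℝ²` such that at each point `f i`
the angle between the segments to the previous and next points of the cycle is `π`. -/
theorem no_straight_line_cycle_with_perfect_angular_resolution (n : ℕ) (hn : 3 ≤ n) :
    ¬ ∃ f : ZMod n → EuclideanSpace ℝ (Fin 2),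
      Function.Injective f ∧
      ∀ i : ZMod n, ∠ (f (i - 1)) (f i) (f (i + 1)) = Real.pi := by
  rintro ⟨f, -, h⟩
  have : NeZero n := ⟨by omega⟩
  obtain ⟨i, hi⟩ := Finite.exists_max fun j ↦ dist (f j) 0
  exact ((angle_eq_pi_iff_sbtw.1 (h i)).dist_lt_max_dist 0).not_ge (max_le (hi _) (hi _))
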